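/- Let p(λ) = |λ|·P₂(λ²) be the symmetrized Fuss–Catalan density of order 2 on [−a, a], a = √(27/4), and let s(z) = ∫_{-a}^{a} p(x)/(x − z) dx be its Stieltjes transform, defined for z with Im z > 0. Then s satisfies the algebraic equation 1 + z s(z) − z s(z)³ = 0 for all z with Im z > 0. -/

import Mathlib

open MeasureTheory Real

/-- The Fuss–Catalan density of order 2 on `(0, 27/4]`. -/
noncomputable def fcDensity2 (x : ℝ) : ℝ :=
  (2 ^ ((1 : ℝ) / 3) * Real.sqrt 3 / (12 * Real.pi)) *
    (2 ^ ((1 : ℝ) / 3) * (27 + 3 * Real.sqrt (81 - 12 * x)) ^ ((2 : ℝ) / 3)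
        - 6 * x ^ ((1 : ℝ) / 3)) /
    (x ^ ((2 : ℝ) / 3) * (27 + 3 * Real.sqrt (81 - 12 * x)) ^ ((1 : ℝ) / 3))

/-- The symmetrized Fuss–Catalan density `p(λ) = |λ| P₂(λ²)`. -/
noncomputable def symFC (l : ℝ) : ℝ := |l| * fcDensity2 (l ^ 2)

/-- The edge `a = √(27/4)` of the support of the symmetrized Fuss–Catalan density. -/
noncomputable def aFC : ℝ := Real.sqrt (27 / 4)

/-- The Stieltjes transform `s(z) = ∫_{-a}^{a} p(x)/(x − z) dx`. -/
noncomputable def stFC (z : ℂ) : ℂ :=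
  ∫ x in (-aFC)..aFC, (symFC x : ℂ) / ((x : ℂ) - z)

lemma aFC_eq : aFC = 3 * √3 / 2 := by
  rw [aFC, Real.sqrt_eq_iff_mul_self_eq (by norm_num) (by positivity)]
  nlinarith [Real.mul_self_sqrt (show (0 : ℝ) ≤ 3 by norm_num)]

lemma symFC_neg (x : ℝ) : symFC (-x) = symFC x := by
  simp [symFC]

/-- The rational parametrization `r ↦ 3√3 r³ / (1 + r⁶)` of the positive half of the support. -/
noncomputable def fcParam (r : ℝ) : ℝ := 3 * √3 * r ^ 3 / (1 + r ^ 6)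

/-- The density pulled back along `fcParam`, times the Jacobian. -/
noncomputable def fcWeight (r : ℝ) : ℝ :=
  9 * √3 * r * (1 - r ^ 2) * (1 - r ^ 6) / (2 * π * (1 + r ^ 6) ^ 2)

lemma hasDerivAt_fcParam (r : ℝ) :
    HasDerivAt fcParam (9 * √3 * r ^ 2 * (1 - r ^ 6) / (1 + r ^ 6) ^ 2) r := by
  have h0 : (1 + r ^ 6 : ℝ) ≠ 0 := by positivity
  have := (((hasDerivAt_pow 3 r).const_mul (3 * √3)).div ((hasDerivAt_pow 6 r).const_add 1) h0)
  refine this.congr_deriv ?_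
  field_simp
  push_cast
  ring

lemma continuous_fcParam : Continuous fcParam :=
  continuous_iff_continuousAt.2 fun r => (hasDerivAt_fcParam r).continuousAt

lemma continuous_fcWeight : Continuous fcWeight := by
  unfold fcWeight
  refine Continuous.div (by fun_prop) (by fun_prop) fun r => ?_
  positivity

lemma strictMonoOn_fcParam : StrictMonoOn fcParam (Set.Icc 0 1) := by
  refine strictMonoOn_of_deriv_pos (convex_Icc 0 1) continuous_fcParam.continuousOn fun r hr => ?_
  rw [interior_Icc] at hr
  rw [(hasDerivAt_fcParam r).deriv]
  have h1 : 0 < 1 - r ^ 6 := sub_pos.2 (pow_lt_one₀ hr.1.le hr.2 (by norm_num))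
  have := hr.1
  positivity

lemma fcParam_image : fcParam '' Set.Ioo 0 1 = Set.Ioo 0 aFC := by
  rw [continuous_fcParam.continuousOn.image_Ioo_of_strictMonoOn zero_le_one strictMonoOn_fcParam,
    aFC_eq]
  norm_num [fcParam]

lemma symFC_fcParam {r : ℝ} (h0 : 0 < r) (h1 : r < 1) :
    symFC (fcParam r) = (1 - r ^ 2) / (2 * π * r) := by
  have h6 : 0 < 1 - r ^ 6 := sub_pos.2 (pow_lt_one₀ h0.le h1 (by norm_num))
  have hs : √3 ^ 2 = (3 : ℝ) := Real.sq_sqrt (by norm_num)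
  have hcube : ∀ {y : ℝ}, 0 ≤ y → (y ^ 3) ^ ((1 : ℝ) / 3) = y := fun {y} hy => by
    rw [← Real.rpow_natCast, ← Real.rpow_mul hy]; norm_num
  have hcube2 : ∀ {y : ℝ}, 0 ≤ y → (y ^ 3) ^ ((2 : ℝ) / 3) = y ^ 2 := fun {y} hy => by
    rw [← Real.rpow_natCast, ← Real.rpow_mul hy]; norm_num
  obtain ⟨t, ht0, ht⟩ : ∃ t : ℝ, 0 < t ∧ t ^ 3 = 2 :=
    ⟨2 ^ ((1 : ℝ) / 3), by positivity, by rw [← Real.rpow_natCast, ← Real.rpow_mul] <;> norm_num⟩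
  obtain ⟨m, hm0, hm⟩ : ∃ m : ℝ, 0 < m ∧ m ^ 3 = 1 + r ^ 6 :=
    ⟨(1 + r ^ 6) ^ ((1 : ℝ) / 3), by positivity, by
      rw [← Real.rpow_natCast, ← Real.rpow_mul (by positivity)]; norm_num⟩
  have hx : fcParam r ^ 2 = (3 * r ^ 2 / m ^ 2) ^ 3 := by
    rw [fcParam, ← hm]
    field_simp
    linear_combination hs
  have hsqrt : √(81 - 12 * fcParam r ^ 2) = 9 * (1 - r ^ 6) / (1 + r ^ 6) := by
    rw [Real.sqrt_eq_iff_mul_self_eq_of_pos (by positivity), fcParam]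
    field_simp
    linear_combination 108 * r ^ 6 * hs
  have hB : 27 + 3 * √(81 - 12 * fcParam r ^ 2) = (3 * t / m) ^ 3 := by
    rw [hsqrt, div_pow, mul_pow, ht, hm]
    field_simp
    ring
  have hx0 : 0 ≤ fcParam r := by unfold fcParam; positivity
  rw [symFC, fcDensity2, hB, hx, hcube (by positivity), hcube (by positivity),
    hcube2 (by positivity), hcube2 (by positivity), abs_of_nonneg hx0, fcParam, ← hm, ← ht,
    hcube ht0.le]
  field_simp
  rw [hs, ht]
  ring

lemma integral_symFC_mul {F : ℝ → ℂ} (hF : Continuous F) :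
    IntervalIntegrable (fun x => (symFC x : ℂ) * F x) volume 0 aFC ∧
      ∫ x in (0 : ℝ)..aFC, (symFC x : ℂ) * F x =
        ∫ r in (0 : ℝ)..1, (fcWeight r : ℂ) * F (fcParam r) := by
  have ha : 0 ≤ aFC := Real.sqrt_nonneg _
  have hd : ∀ r ∈ Set.Ioo (0 : ℝ) 1, HasDerivWithinAt fcParam _ (Set.Ioo 0 1) r :=
    fun r _ => (hasDerivAt_fcParam r).hasDerivWithinAt
  have hinj : Set.InjOn fcParam (Set.Ioo 0 1) :=
    strictMonoOn_fcParam.injOn.mono Set.Ioo_subset_Icc_self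
  have heq : Set.EqOn (fun r => |9 * √3 * r ^ 2 * (1 - r ^ 6) / (1 + r ^ 6) ^ 2| •
      ((symFC (fcParam r) : ℂ) * F (fcParam r)))
      (fun r => (fcWeight r : ℂ) * F (fcParam r)) (Set.Ioo 0 1) := fun r hr => by
    have h6 : 0 < 1 - r ^ 6 := sub_pos.2 (pow_lt_one₀ hr.1.le hr.2 (by norm_num))
    have h0 := hr.1
    have hW : fcWeight r = 9 * √3 * r ^ 2 * (1 - r ^ 6) / (1 + r ^ 6) ^ 2 *
        symFC (fcParam r) := by
      rw [symFC_fcParam hr.1 hr.2, fcWeight]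
      field_simp
    simp only
    rw [abs_of_nonneg (by positivity), hW, Complex.real_smul]
    push_cast
    ring
  have hcont : Continuous fun r => (fcWeight r : ℂ) * F (fcParam r) :=
    (Complex.continuous_ofReal.comp continuous_fcWeight).mul (hF.comp continuous_fcParam)
  constructor
  · rw [intervalIntegrable_iff_integrableOn_Ioo_of_le ha, ← fcParam_image,
      integrableOn_image_iff_integrableOn_abs_deriv_smul measurableSet_Ioo hd hinj,
      integrableOn_congr_fun heq measurableSet_Ioo,
      ← intervalIntegrable_iff_integrableOn_Ioo_of_le zero_le_one]
    exact hcont.intervalIntegrable _ _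
  · rw [intervalIntegral.integral_of_le ha, intervalIntegral.integral_of_le zero_le_one,
      integral_Ioc_eq_integral_Ioo, integral_Ioc_eq_integral_Ioo, ← fcParam_image,
      integral_image_eq_integral_abs_deriv_smul measurableSet_Ioo hd hinj]
    exact setIntegral_congr_fun measurableSet_Ioo heq

lemma stFC_eq_integral {z : ℂ} (hz : z.im ≠ 0) :
    stFC z = ∫ r in (0 : ℝ)..1,
      (fcWeight r : ℂ) * (1 / (fcParam r - z) - 1 / (fcParam r + z)) := by
  have hne : ∀ x : ℝ, (x : ℂ) - z ≠ 0 := fun x h => hz (by simpa using congrArg Complex.im h)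
  have hne' : ∀ x : ℝ, (x : ℂ) + z ≠ 0 := fun x h => hz (by simpa using congrArg Complex.im h)
  have hF : Continuous fun x : ℝ => 1 / ((x : ℂ) - z) :=
    continuous_const.div (by fun_prop) hne
  have hG : Continuous fun x : ℝ => 1 / ((x : ℂ) + z) :=
    continuous_const.div (by fun_prop) hne'
  obtain ⟨i1, -⟩ := integral_symFC_mul hF
  obtain ⟨i2, -⟩ := integral_symFC_mul hG
  have e3 : ∫ x in (0 : ℝ)..aFC, (symFC x : ℂ) * (1 / ((x : ℂ) - z) - 1 / ((x : ℂ) + z)) = _ :=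
    (integral_symFC_mul (hF.sub hG)).2
  have hneg : ∀ x : ℝ, (symFC (-x) : ℂ) * (1 / (((-x : ℝ) : ℂ) - z)) =
      -((symFC x : ℂ) * (1 / ((x : ℂ) + z))) := fun x => by
    rw [symFC_neg, Complex.ofReal_neg, show (-(x : ℂ) - z) = -(x + z) by ring,
      one_div_neg_eq_neg_one_div]
    ring
  have i2' : IntervalIntegrable (fun x : ℝ => (symFC x : ℂ) * (1 / ((x : ℂ) - z)))
      volume (-aFC) 0 := by
    have h : IntervalIntegrable (fun x : ℝ => (symFC (-x) : ℂ) * (1 / (((-x : ℝ) : ℂ) - z)))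
        volume 0 aFC := by
      simp_rw [hneg]
      exact i2.neg
    rw [IntervalIntegrable.iff_comp_neg enorm_ne_top] at h
    simpa using h.symm
  have e2 : ∫ x in (-aFC)..0, (symFC x : ℂ) * (1 / ((x : ℂ) - z)) =
      -∫ x in (0 : ℝ)..aFC, (symFC x : ℂ) * (1 / ((x : ℂ) + z)) := by
    rw [← intervalIntegral.integral_neg]
    simp_rw [← hneg]
    rw [intervalIntegral.integral_comp_neg (fun x : ℝ => (symFC x : ℂ) * (1 / ((x : ℂ) - z))),
      neg_zero]
  simp_rw [stFC, div_eq_mul_one_div (symFC _ : ℂ)]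
  rw [← intervalIntegral.integral_add_adjacent_intervals i2' i1, e2, neg_add_eq_sub,
    ← intervalIntegral.integral_sub i1 i2]
  simp_rw [← mul_sub]
  exact e3

lemma Complex.log_one_add_sub_log_one_add_inv {y : ℂ} (hy : y ∈ slitPlane) :
    log (1 + y) - log (1 + y⁻¹) = log y := by
  have hy0 : y ≠ 0 := slitPlane_ne_zero hy
  have hπ := Real.pi_pos
  have hn : 0 < normSq y := normSq_pos.2 hy0
  have him : (1 + y⁻¹).im = -(y.im / normSq y) := by simp [inv_im, neg_div]
  have hmul : 1 + y = (1 + y⁻¹) * y := by field_simp; ring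
  suffices h : 1 + y⁻¹ ≠ 0 ∧ arg (1 + y⁻¹) + arg y ∈ Set.Ioc (-π) π by
    rw [hmul, log_mul h.1 hy0 h.2, add_sub_cancel_left]
  rcases lt_trichotomy y.im 0 with h | h | h
  · have h1 : 0 < (1 + y⁻¹).im := by rw [him]; exact neg_pos.2 (div_neg_of_neg_of_pos h hn)
    refine ⟨fun h0 => by simp [h0] at h1, ?_⟩
    have := arg_nonneg_iff.2 h1.le
    have := arg_neg_iff.2 h
    constructor <;> linarith [arg_le_pi (1 + y⁻¹), neg_pi_lt_arg y]
  · have hre : 0 < y.re := (mem_slitPlane_iff.1 hy).resolve_right (not_not.2 h)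
    obtain ⟨t, rfl⟩ : ∃ t : ℝ, y = t := ⟨y.re, Complex.ext rfl (by simpa using h)⟩
    rw [ofReal_re] at hre
    have h1 : 0 < 1 + t⁻¹ := by positivity
    have hc : 1 + (t : ℂ)⁻¹ = ((1 + t⁻¹ : ℝ) : ℂ) := by push_cast; rfl
    rw [hc, arg_ofReal_of_nonneg h1.le, arg_ofReal_of_nonneg hre.le]
    exact ⟨ofReal_ne_zero.2 h1.ne', by simpa using hπ, by simpa using hπ.le⟩
  · have h1 : (1 + y⁻¹).im < 0 := by rw [him]; exact neg_neg_of_pos (div_pos h hn)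
    refine ⟨fun h0 => by simp [h0] at h1, ?_⟩
    have := arg_neg_iff.2 h1
    have := arg_nonneg_iff.2 h.le
    constructor <;> linarith [arg_le_pi y, neg_pi_lt_arg (1 + y⁻¹)]

lemma Complex.one_add_mul_mem_slitPlane {y : ℂ} (hy : y ∈ slitPlane) {q : ℝ} (hq : 0 ≤ q) :
    1 + q * y ∈ slitPlane := by
  rcases hq.eq_or_lt with rfl | hq
  · simp
  · rw [mem_slitPlane_iff] at hy ⊢
    by_cases h : y.im = 0
    · left
      have := hy.resolve_right (not_not.2 h)
      simp
      positivity
    · right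
      simpa [hq.ne'] using h

lemma Complex.exp_mem_slitPlane_of_abs_im_lt {x : ℂ} (hx : |x.im| < π) : exp x ∈ slitPlane := by
  rw [abs_lt] at hx
  rw [mem_slitPlane_iff_arg]
  have : arg (exp x) = x.im := by rw [← log_im, log_exp hx.1 hx.2.le]
  exact ⟨by rw [this]; exact hx.2.ne, exp_ne_zero x⟩

lemma Complex.hasDerivAt_log_one_add_sub {y : ℂ} (hy : y ∈ slitPlane) (hy' : y⁻¹ ∈ slitPlane)
    (r : ℝ) :
    HasDerivAt (fun r : ℝ => log (1 + (r ^ 2 : ℝ) * y) - log (1 + (r ^ 2 : ℝ) * y⁻¹))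
      (2 * r * (y / (1 + (r ^ 2 : ℝ) * y) - y⁻¹ / (1 + (r ^ 2 : ℝ) * y⁻¹))) r := by
  have key : ∀ w ∈ slitPlane, HasDerivAt (fun r : ℝ => log (1 + (r ^ 2 : ℝ) * w))
      (2 * r * w / (1 + (r ^ 2 : ℝ) * w)) r := fun w hw => by
    have h1 := ((hasDerivAt_pow 2 r).ofReal_comp.mul_const w).const_add 1
    refine (h1.clog_real (one_add_mul_mem_slitPlane hw (sq_nonneg r))).congr_deriv ?_
    simp
  refine ((key y hy).sub (key _ hy')).congr_deriv ?_
  ring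

section CubeRoots
variable {ω d q : ℂ}

lemma one_add_cube_eq_prod (hω : 1 + ω + ω ^ 2 = 0) :
    1 + q ^ 3 * d ^ 3 = (1 + q * d) * (1 + q * (d * ω)) * (1 + q * (d * ω ^ 2)) := by
  grind

lemma sum_cube_roots_sq (hω : 1 + ω + ω ^ 2 = 0) (h0 : 1 + q * d ≠ 0)
    (h1 : 1 + q * (d * ω) ≠ 0) (h2 : 1 + q * (d * ω ^ 2) ≠ 0) :
    d / (1 + q * d) + ω * (d * ω / (1 + q * (d * ω))) +
      ω ^ 2 * (d * ω ^ 2 / (1 + q * (d * ω ^ 2))) = -3 * d ^ 2 * q / (1 + q ^ 3 * d ^ 3) := by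
  rw [one_add_cube_eq_prod hω]
  generalize hA : 1 + q * d = A at *
  generalize hB : 1 + q * (d * ω) = B at *
  generalize hC : 1 + q * (d * ω ^ 2) = C at *
  field_simp
  subst hA hB hC
  grind only

lemma sum_cube_roots_one (hω : 1 + ω + ω ^ 2 = 0) (h0 : 1 + q * d ≠ 0)
    (h1 : 1 + q * (d * ω) ≠ 0) (h2 : 1 + q * (d * ω ^ 2) ≠ 0) :
    d / (1 + q * d) + ω ^ 2 * (d * ω / (1 + q * (d * ω))) +
      ω * (d * ω ^ 2 / (1 + q * (d * ω ^ 2))) = 3 * d / (1 + q ^ 3 * d ^ 3) := by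
  rw [one_add_cube_eq_prod hω]
  generalize hA : 1 + q * d = A at *
  generalize hB : 1 + q * (d * ω) = B at *
  generalize hC : 1 + q * (d * ω ^ 2) = C at *
  field_simp
  subst hA hB hC
  grind only

end CubeRoots

lemma fcWeight_mul_cauchy_kernel {K z : ℂ} {r : ℝ} (hK : K ≠ 0) (hK6 : K ^ 6 - 1 ≠ 0)
    (hz : z * (K ^ 6 - 1) = -(3 * √3) * Complex.I * K ^ 3)
    (h1 : 1 + (r ^ 2) ^ 3 * K ^ 6 ≠ 0) (h2 : K ^ 6 + (r ^ 2) ^ 3 ≠ 0)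
    (hm : (fcParam r : ℂ) - z ≠ 0) (hp : (fcParam r : ℂ) + z ≠ 0) :
    2 * π * Complex.I * (fcWeight r * (1 / (fcParam r - z) - 1 / (fcParam r + z))) =
      2 * r * (3 * K ^ 3 * (1 - r ^ 2) *
        (1 / (1 + (r ^ 2) ^ 3 * K ^ 6) - 1 / (K ^ 6 + (r ^ 2) ^ 3))) := by
  have hπ : (π : ℂ) ≠ 0 := Complex.ofReal_ne_zero.2 pi_ne_zero
  have hs : (√3 : ℂ) ^ 2 = 3 := by norm_cast; exact Real.sq_sqrt (by norm_num)
  have hr : (1 + (r : ℂ) ^ 6) ≠ 0 := by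
    have : (1 + r ^ 6 : ℝ) ≠ 0 := by positivity
    exact_mod_cast this
  have hz' : z = -(3 * √3) * Complex.I * K ^ 3 / (K ^ 6 - 1) := eq_div_of_mul_eq hK6 hz
  have hX : (fcParam r : ℂ) = 3 * √3 * r ^ 3 / (1 + r ^ 6) := by
    rw [fcParam]; push_cast; ring
  have hsq : ((fcParam r : ℂ) - z) * (fcParam r + z) =
      27 * ((1 + (r ^ 2) ^ 3 * K ^ 6) * (K ^ 6 + (r ^ 2) ^ 3)) /
        ((1 + r ^ 6) ^ 2 * (K ^ 6 - 1) ^ 2) := by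
    rw [hX, hz']
    field_simp
    linear_combination
      9 * ((r : ℂ) ^ 6 * (K ^ 6 - 1) ^ 2 - (1 + r ^ 6) ^ 2 * Complex.I ^ 2 * K ^ 6) * hs -
        27 * (1 + (r : ℂ) ^ 6) ^ 2 * K ^ 6 * Complex.I_sq
  have hker : 1 / ((fcParam r : ℂ) - z) - 1 / (fcParam r + z) =
      2 * z / (((fcParam r : ℂ) - z) * (fcParam r + z)) := by
    field_simp
    ring
  have hW : (fcWeight r : ℂ) =
      9 * √3 * r * (1 - r ^ 2) * (1 - r ^ 6) / (2 * π * (1 + r ^ 6) ^ 2) := by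
    rw [fcWeight]; push_cast; ring
  rw [hker, hsq, hW, hz']
  generalize hA : 1 + ((r : ℂ) ^ 2) ^ 3 * K ^ 6 = A at *
  generalize hB : K ^ 6 + ((r : ℂ) ^ 2) ^ 3 = B at *
  field_simp
  subst hA hB
  linear_combination (-9 * Complex.I ^ 2 * (r * (1 - r ^ 2) * (1 - r ^ 6) * (K ^ 6 - 1))) * hs -
    27 * (r * (1 - r ^ 2) * (1 - r ^ 6) * (K ^ 6 - 1)) * Complex.I_sq

lemma cube_roots_kernel {ω K q : ℂ} (hω : 1 + ω + ω ^ 2 = 0) (hK : K ≠ 0)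
    (h0 : 1 + q * (K ^ 2)⁻¹ ≠ 0) (h1 : 1 + q * ((K ^ 2)⁻¹ * ω) ≠ 0)
    (h2 : 1 + q * ((K ^ 2)⁻¹ * ω ^ 2) ≠ 0) (h0' : 1 + q * K ^ 2 ≠ 0)
    (h1' : 1 + q * (K ^ 2 * ω) ≠ 0) (h2' : 1 + q * (K ^ 2 * ω ^ 2) ≠ 0) :
    (1 + q ^ 3 * K ^ 6 ≠ 0 ∧ K ^ 6 + q ^ 3 ≠ 0) ∧
    -((K + K⁻¹) * ((K ^ 2)⁻¹ / (1 + q * (K ^ 2)⁻¹) - K ^ 2 / (1 + q * K ^ 2)) +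
      (K * ω + K⁻¹ * ω ^ 2) * ((K ^ 2)⁻¹ * ω / (1 + q * ((K ^ 2)⁻¹ * ω)) -
        K ^ 2 * ω ^ 2 / (1 + q * (K ^ 2 * ω ^ 2))) +
      (K * ω ^ 2 + K⁻¹ * ω) * ((K ^ 2)⁻¹ * ω ^ 2 / (1 + q * ((K ^ 2)⁻¹ * ω ^ 2)) -
        K ^ 2 * ω / (1 + q * (K ^ 2 * ω)))) =
    3 * K ^ 3 * (1 - q) * (1 / (1 + q ^ 3 * K ^ 6) - 1 / (K ^ 6 + q ^ 3)) := by
  have e1 := sum_cube_roots_sq hω h0 h1 h2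
  have e2 := sum_cube_roots_one hω h0 h1 h2
  have e3 := sum_cube_roots_sq hω h0' h1' h2'
  have e4 := sum_cube_roots_one hω h0' h1' h2'
  have p1 : 1 + q ^ 3 * K ^ 6 ≠ 0 := by
    rw [show K ^ 6 = (K ^ 2) ^ 3 by ring, one_add_cube_eq_prod hω]
    exact mul_ne_zero (mul_ne_zero h0' h1') h2'
  have p2 : 1 + q ^ 3 * (K ^ 2)⁻¹ ^ 3 ≠ 0 := by
    rw [one_add_cube_eq_prod hω]
    exact mul_ne_zero (mul_ne_zero h0 h1) h2
  have p3 : K ^ 6 + q ^ 3 = K ^ 6 * (1 + q ^ 3 * (K ^ 2)⁻¹ ^ 3) := by field_simp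
  have p4 : K ^ 6 + q ^ 3 ≠ 0 := by rw [p3]; exact mul_ne_zero (pow_ne_zero _ hK) p2
  refine ⟨⟨p1, p4⟩, ?_⟩
  have f1 : -3 * (K ^ 2)⁻¹ ^ 2 * q / (1 + q ^ 3 * (K ^ 2)⁻¹ ^ 3) =
      -3 * K ^ 2 * q * (1 / (K ^ 6 + q ^ 3)) := by
    rw [p3]; field_simp
  have f2 : 3 * (K ^ 2)⁻¹ / (1 + q ^ 3 * (K ^ 2)⁻¹ ^ 3) = 3 * K ^ 4 * (1 / (K ^ 6 + q ^ 3)) := by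
    rw [p3]; field_simp
  have f3 : -3 * (K ^ 2) ^ 2 * q / (1 + q ^ 3 * (K ^ 2) ^ 3) =
      -3 * K ^ 4 * q * (1 / (1 + q ^ 3 * K ^ 6)) := by ring
  have f4 : 3 * K ^ 2 / (1 + q ^ 3 * (K ^ 2) ^ 3) = 3 * K ^ 2 * (1 / (1 + q ^ 3 * K ^ 6)) := by
    ring
  rw [f1] at e1
  rw [f2] at e2
  rw [f3] at e3
  rw [f4] at e4
  have hKi : K * K⁻¹ = 1 := mul_inv_cancel₀ hK
  linear_combination (-K) * e1 - K⁻¹ * e2 + K⁻¹ * e3 + K * e4 +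
    (-3 * K ^ 3 * (1 / (K ^ 6 + q ^ 3)) - 3 * K ^ 3 * q * (1 / (1 + q ^ 3 * K ^ 6))) * hKi

open Complex in
lemma stFC_eq_of_exp {z L : ℂ} (hz : z.im ≠ 0) (hL : |L.im| < π / 6)
    (hzL : z * (exp L ^ 6 - 1) = -(3 * √3) * I * exp L ^ 3) :
    stFC z = -(√3 * I / 3) * (exp L - (exp L)⁻¹) := by
  have hπ := Real.pi_pos
  rw [abs_lt] at hL
  set K := exp L with hKdef
  have hK : K ≠ 0 := Complex.exp_ne_zero L
  have hK6 : K ^ 6 - 1 ≠ 0 := fun h => by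
    rw [h, mul_zero, eq_comm] at hzL
    simp [hK] at hzL
  set ω := exp (2 * π / 3 * I) with hωdef
  have hω2 : ω ^ 2 = exp (-(2 * π / 3 * I)) := by
    rw [hωdef, ← Complex.exp_nat_mul, ← mul_one (exp (-(2 * π / 3 * I))), ← exp_two_pi_mul_I, ← Complex.exp_add]
    congr 1
    push_cast
    ring
  have hω3 : ω * ω ^ 2 = 1 := by rw [hω2, hωdef, ← Complex.exp_add, add_neg_cancel, Complex.exp_zero]
  have hωval : ω = (-1 + √3 * I) / 2 := by
    have hc : Real.cos (2 * π / 3) = -(1 / 2) := by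
      rw [show 2 * π / 3 = π - π / 3 by ring, Real.cos_pi_sub, Real.cos_pi_div_three]
    have hs : Real.sin (2 * π / 3) = √3 / 2 := by
      rw [show 2 * π / 3 = π - π / 3 by ring, Real.sin_pi_sub, Real.sin_pi_div_three]
    have : (2 * π / 3 : ℂ) = ((2 * π / 3 : ℝ) : ℂ) := by push_cast; rfl
    rw [hωdef, exp_mul_I, this, ← ofReal_cos, ← ofReal_sin, hc, hs]
    push_cast
    ring
  have hs3 : (√3 : ℂ) ^ 2 = 3 := by norm_cast; exact Real.sq_sqrt (by norm_num)
  have hω : 1 + ω + ω ^ 2 = 0 := by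
    rw [hωval]
    grind only [I_sq]
  have hωsub : ω - ω ^ 2 = √3 * I := by
    linear_combination 2 * hωval - hω
  have hc : (K ^ 2)⁻¹ = exp (-(2 * L)) := by
    rw [hKdef, ← Complex.exp_nat_mul, ← Complex.exp_neg]; norm_num
  have him : (2 * π / 3 * I : ℂ).im = 2 * π / 3 := by
    rw [show (2 * π / 3 * I : ℂ) = ((2 * π / 3 : ℝ) : ℂ) * I by push_cast; ring, im_ofReal_mul]
    simp
  have hLim : (2 * L).im = 2 * L.im := by simp
  obtain ⟨b0, b1, b2⟩ : |(-(2 * L)).im| < π ∧ |(-(2 * L) + 2 * π / 3 * I).im| < π ∧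
      |(-(2 * L) + -(2 * π / 3 * I)).im| < π := by
    simp only [add_im, neg_im, him, hLim]
    refine ⟨?_, ?_, ?_⟩ <;> rw [abs_lt] <;> constructor <;> linarith
  have y1 : (K ^ 2)⁻¹ * ω = exp (-(2 * L) + 2 * π / 3 * I) := by rw [hc, hωdef, Complex.exp_add]
  have y2 : (K ^ 2)⁻¹ * ω ^ 2 = exp (-(2 * L) + -(2 * π / 3 * I)) := by rw [hc, hω2, Complex.exp_add]
  have i0 : ((K ^ 2)⁻¹)⁻¹ = K ^ 2 := inv_inv _
  have i1 : ((K ^ 2)⁻¹ * ω)⁻¹ = K ^ 2 * ω ^ 2 := by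
    rw [mul_inv, inv_inv, inv_eq_of_mul_eq_one_right hω3]
  have i2 : ((K ^ 2)⁻¹ * ω ^ 2)⁻¹ = K ^ 2 * ω := by
    rw [mul_inv, inv_inv, inv_eq_of_mul_eq_one_left hω3]
  have m0 := exp_mem_slitPlane_of_abs_im_lt b0
  have m1 := exp_mem_slitPlane_of_abs_im_lt b1
  have m2 := exp_mem_slitPlane_of_abs_im_lt b2
  have l0 := Complex.log_exp (abs_lt.1 b0).1 (abs_lt.1 b0).2.le
  have l1 := Complex.log_exp (abs_lt.1 b1).1 (abs_lt.1 b1).2.le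
  have l2 := Complex.log_exp (abs_lt.1 b2).1 (abs_lt.1 b2).2.le
  have hinv : ∀ {x : ℂ}, |x.im| < π → (exp x)⁻¹ ∈ slitPlane := fun h => by
    rw [← Complex.exp_neg]
    exact exp_mem_slitPlane_of_abs_im_lt (by rwa [neg_im, abs_neg])
  have n0 := hinv b0
  have n1 := hinv b1
  have n2 := hinv b2
  rw [← hc] at m0 l0 n0
  rw [← y1] at m1 l1 n1
  rw [← y2] at m2 l2 n2
  have hne : ∀ {w : ℂ}, w ∈ slitPlane → ∀ r : ℝ, 1 + (r ^ 2 : ℝ) * w ≠ 0 := fun hw r =>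
    slitPlane_ne_zero (one_add_mul_mem_slitPlane hw (sq_nonneg r))
  have zm : ∀ x : ℝ, (x : ℂ) - z ≠ 0 := fun x h => hz (by simpa using congrArg im h)
  have zp : ∀ x : ℝ, (x : ℂ) + z ≠ 0 := fun x h => hz (by simpa using congrArg im h)
  have hderiv := fun r : ℝ => ((((hasDerivAt_log_one_add_sub m0 n0 r).const_mul (K + K⁻¹)).add
    ((hasDerivAt_log_one_add_sub m1 n1 r).const_mul (K * ω + K⁻¹ * ω ^ 2))).add
    ((hasDerivAt_log_one_add_sub m2 n2 r).const_mul (K * ω ^ 2 + K⁻¹ * ω))).neg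
  have hderiv' := fun r : ℝ => (hderiv r).congr_deriv
    (g' := 2 * π * I * (fcWeight r * (1 / (fcParam r - z) - 1 / (fcParam r + z)))) <| by
      have h0' := hne n0 r
      have h1' := hne n1 r
      have h2' := hne n2 r
      rw [i0] at h0' ⊢
      rw [i1] at h1' ⊢
      rw [i2] at h2' ⊢
      obtain ⟨⟨p1, p2⟩, e⟩ :=
        cube_roots_kernel hω hK (hne m0 r) (hne m1 r) (hne m2 r) h0' h2' h1'
      push_cast at p1 p2 e ⊢
      rw [fcWeight_mul_cauchy_kernel hK hK6 hzL p1 p2 (zm _) (zp _), ← e]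
      ring
  have hcont : Continuous fun r : ℝ =>
      2 * π * I * ((fcWeight r : ℂ) * (1 / (fcParam r - z) - 1 / (fcParam r + z))) := by
    have hX : Continuous fun r => (fcParam r : ℂ) :=
      continuous_ofReal.comp continuous_fcParam
    exact continuous_const.mul ((continuous_ofReal.comp continuous_fcWeight).mul
      ((continuous_const.div (hX.sub continuous_const) fun r => zm _).sub
        (continuous_const.div (hX.add continuous_const) fun r => zp _)))
  have hint := intervalIntegral.integral_eq_sub_of_hasDerivAt (a := 0) (b := 1)
    (fun r _ => hderiv' r) (hcont.intervalIntegrable _ _)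
  rw [intervalIntegral.integral_const_mul, ← stFC_eq_integral hz] at hint
  have v0 := log_one_add_sub_log_one_add_inv m0
  have v1 := log_one_add_sub_log_one_add_inv m1
  have v2 := log_one_add_sub_log_one_add_inv m2
  rw [l0] at v0
  rw [l1] at v1
  rw [l2] at v2
  simp only [Pi.add_apply, Pi.neg_apply, one_pow, zero_pow two_ne_zero, ofReal_one, ofReal_zero,
    one_mul, zero_mul, add_zero, Complex.log_one, sub_zero, mul_zero, neg_zero] at hint
  rw [v0, v1, v2] at hint
  apply mul_left_cancel₀ two_pi_I_ne_zero
  rw [hint]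
  linear_combination (-(2 * π * I / 3) * (K - K⁻¹)) * hωsub + 2 * L * (K + K⁻¹) * hω

open Complex in
lemma exists_exp_of_im_ne_zero {z : ℂ} (hz : z.im ≠ 0) :
    ∃ L : ℂ, |L.im| < π / 6 ∧ z * (exp L ^ 6 - 1) = -(3 * √3) * I * exp L ^ 3 := by
  have hz0 : z ≠ 0 := fun h => hz (by simp [h])
  suffices h : ∃ k : ℂ, 0 < k.re ∧ z * (k ^ 2 - 1) = -(3 * √3) * I * k by
    obtain ⟨k, hre, hk⟩ := h
    have hk0 : k ≠ 0 := fun h0 => by simp [h0] at hre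
    have harg := abs_arg_lt_pi_div_two_iff.2 (Or.inl hre)
    have h3 : exp (log k / 3) ^ 3 = k := by
      rw [← Complex.exp_nat_mul, show ((3 : ℕ) : ℂ) * (log k / 3) = log k by push_cast; ring, Complex.exp_log hk0]
    refine ⟨log k / 3, ?_, ?_⟩
    · have : (log k / 3).im = arg k / 3 := by
        rw [show log k / 3 = log k / ((3 : ℝ) : ℂ) by push_cast; rfl, div_ofReal_im, log_im]
      rw [this, abs_div, abs_of_pos (by norm_num : (0 : ℝ) < 3)]
      linarith
    · rw [show exp (log k / 3) ^ 6 = (exp (log k / 3) ^ 3) ^ 2 by ring, h3, hk]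
  obtain ⟨t, ht⟩ := IsAlgClosed.exists_pow_nat_eq ((3 * √3 * I / (2 * z)) ^ 2 + 1) two_pos
  obtain ⟨k, hk⟩ : ∃ k : ℂ, z * (k ^ 2 - 1) = -(3 * √3) * I * k := by
    refine ⟨-(3 * √3 * I / (2 * z)) + t, ?_⟩
    have hp : z * (2 * (3 * √3 * I / (2 * z))) = 3 * √3 * I := by field_simp
    generalize 3 * √3 * I / (2 * z) = p at *
    linear_combination z * ht + (t - p) * (-hp)
  have hk0 : k ≠ 0 := fun h => hz0 (by simpa [h] using hk)
  have hre : k.re ≠ 0 := fun h => by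
    have hky : k = k.im * I := by apply Complex.ext <;> simp [h]
    have hk' : z * ((-(k.im ^ 2 + 1) : ℝ) : ℂ) = ((3 * √3 * k.im : ℝ) : ℂ) := by
      rw [hky] at hk
      push_cast
      linear_combination hk - (z * k.im ^ 2 + 3 * √3 * k.im) * I_sq
    have him := congrArg im hk'
    rw [im_mul_ofReal, ofReal_im] at him
    exact (mul_ne_zero hz (by nlinarith [sq_nonneg k.im])) him
  rcases hre.lt_or_gt with h | h
  · refine ⟨-k⁻¹, ?_, ?_⟩
    · rw [neg_re, inv_re, neg_pos]
      exact div_neg_of_neg_of_pos h (normSq_pos.2 hk0)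
    · field_simp
      linear_combination -hk
  · exact ⟨k, h, hk⟩

/-- The Stieltjes transform of the symmetrized Fuss–Catalan density of order 2 satisfies
`1 + z s(z) − z s(z)³ = 0` in the upper half plane. -/
theorem stieltjes_symFC_algebraic_equation :
    ∀ z : ℂ, 0 < z.im → 1 + z * stFC z - z * (stFC z) ^ 3 = 0 := by
  intro z hz
  obtain ⟨L, hL, hzL⟩ := exists_exp_of_im_ne_zero hz.ne'
  rw [stFC_eq_of_exp hz.ne' hL hzL]
  have hK := Complex.exp_ne_zero L
  have hs3 : (√3 : ℂ) ^ 2 = 3 := by norm_cast; exact Real.sq_sqrt (by norm_num)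
  generalize Complex.exp L = K at *
  field_simp
  linear_combination (-3 * √3 * Complex.I) * hzL +
    (9 * K ^ 3 + z * (K ^ 2 - 1) ^ 3 * √3 * Complex.I) *
      (Complex.I ^ 2 * hs3 + 3 * Complex.I_sq)
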